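/- arXiv:2010.03697 — 13 statements merged into one kernel-verified Lean document; each statement's English description precedes it below -/
import Mathlib

section
/- Let d_x, d, N be positive integers and let relu denote the map x ↦ max(x,0) applied entrywise to matrices. Define the one-hidden-layer ReLU encoder Φ_E(X; W_e¹, W_e²) = W_e² · relu(W_e¹ X) and decoder Φ_D(Z; W_d¹, W_d²) = W_d² · relu(W_d¹ Z). Then for every data matrix X ∈ ℝ^{d_x×N}, every λ > 0, every choice of weight matrices (W_e¹, W_e², W_d¹, W_d²) of compatible sizes, every C ∈ ℝ^{N×N}, and every ε > 0, there exist weight matrices (Ŵ_e¹, Ŵ_e², Ŵ_d¹, Ŵ_d²) of the same sizes and Ĉ ∈ ℝ^{N×N} such that Φ_D(Φ_E(X; Ŵ_e¹, Ŵ_e²) Ĉ; Ŵ_d¹, Ŵ_d²) = Φ_D(Φ_E(X; W_e¹, W_e²) C; W_d¹, W_d²) and (1/2)·‖Φ_E(X; Ŵ_e¹, Ŵ_e²) Ĉ − Φ_E(X; Ŵ_e¹, Ŵ_e²)‖_F² + λ·‖Ĉ‖₁ < ε. -/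
open Matrix

/-- Entrywise ReLU applied to a matrix. -/
noncomputable def relu {m n : ℕ} (A : Matrix (Fin m) (Fin n) ℝ) : Matrix (Fin m) (Fin n) ℝ :=
  fun i j => max (A i j) 0

/-- Squared Frobenius norm. -/
noncomputable def frobSq {m n : ℕ} (A : Matrix (Fin m) (Fin n) ℝ) : ℝ :=
  ∑ i, ∑ j, A i j ^ 2

/-- Entrywise ℓ1 norm of a matrix. -/
noncomputable def l1 {m n : ℕ} (A : Matrix (Fin m) (Fin n) ℝ) : ℝ :=
  ∑ i, ∑ j, |A i j|

/-- The self-expressive loss of `t • Z` and `t • C` is continuous in `t` and vanishes at `0`,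
so it is below any positive bound for some `t > 0`. -/
lemma exists_pos_smul_loss_lt {d N : ℕ} (Z : Matrix (Fin d) (Fin N) ℝ)
    (C : Matrix (Fin N) (Fin N) ℝ) (lam : ℝ) {ε : ℝ} (hε : 0 < ε) :
    ∃ t : ℝ, 0 < t ∧
      (1 / 2) * frobSq ((t • Z) * (t • C) - t • Z) + lam * l1 (t • C) < ε := by
  have hcont : Continuous fun t : ℝ =>
      (1 / 2) * frobSq ((t • Z) * (t • C) - t • Z) + lam * l1 (t • C) := by
    simp only [frobSq, l1, Matrix.smul_mul, Matrix.mul_smul, Matrix.sub_apply,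
      Matrix.smul_apply, smul_eq_mul]
    fun_prop
  have hzero : (1 / 2) * frobSq (((0 : ℝ) • Z) * ((0 : ℝ) • C) - (0 : ℝ) • Z)
      + lam * l1 ((0 : ℝ) • C) < ε := by
    simpa [frobSq, l1] using hε
  have hnear := (hcont.tendsto 0).eventually (gt_mem_nhds hzero)
  obtain ⟨t, ht, htpos⟩ :=
    ((hnear.filter_mono nhdsWithin_le_nhds).and self_mem_nhdsWithin :
      ∀ᶠ t in nhdsWithin (0 : ℝ) (Set.Ioi 0), _ ∧ t ∈ Set.Ioi (0 : ℝ)).exists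
  exact ⟨t, htpos, ht⟩

theorem stmt0 (dx d N he hd : ℕ) (hdx : 0 < dx) (hd' : 0 < d) (hN : 0 < N)
    (X : Matrix (Fin dx) (Fin N) ℝ) (lam : ℝ) (hlam : 0 < lam)
    (We1 : Matrix (Fin he) (Fin dx) ℝ) (We2 : Matrix (Fin d) (Fin he) ℝ)
    (Wd1 : Matrix (Fin hd) (Fin d) ℝ) (Wd2 : Matrix (Fin dx) (Fin hd) ℝ)
    (C : Matrix (Fin N) (Fin N) ℝ) (ε : ℝ) (hε : 0 < ε) :
    ∃ (We1' : Matrix (Fin he) (Fin dx) ℝ) (We2' : Matrix (Fin d) (Fin he) ℝ)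
      (Wd1' : Matrix (Fin hd) (Fin d) ℝ) (Wd2' : Matrix (Fin dx) (Fin hd) ℝ)
      (C' : Matrix (Fin N) (Fin N) ℝ),
      Wd2' * relu (Wd1' * (We2' * relu (We1' * X) * C')) =
        Wd2 * relu (Wd1 * (We2 * relu (We1 * X) * C)) ∧
      (1 / 2) * frobSq (We2' * relu (We1' * X) * C' - We2' * relu (We1' * X))
        + lam * l1 C' < ε := by
  obtain ⟨t, ht, hloss⟩ := exists_pos_smul_loss_lt (We2 * relu (We1 * X)) C lam hε
  refine ⟨We1, t • We2, (t * t)⁻¹ • Wd1, Wd2, t • C, ?_, ?_⟩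
  · have hscale : t * t * (t * t)⁻¹ = 1 := mul_inv_cancel₀ (mul_pos ht ht).ne'
    simp only [Matrix.smul_mul, Matrix.mul_smul, smul_smul]
    rw [hscale, one_smul]
  · simpa only [Matrix.smul_mul] using hloss
end

section
/- Let d, N be positive integers, τ > 0, λ > 0, and let θ : ℝ^{N×N} → ℝ be bounded below. Define F(Z,C) = (1/2)‖ZC − Z‖_F² + λθ(C). Then the infimum of F(Z,C) over all C ∈ ℝ^{N×N} and all Z ∈ ℝ^{d×N} satisfying ‖Z‖_F² ≥ τ equals the infimum over C ∈ ℝ^{N×N} of (τ/2)·μ_min((C−I)(C−I)ᵀ) + λθ(C), where μ_min(M) denotes the smallest eigenvalue of the real symmetric positive semidefinite matrix M and I is the N×N identity matrix. -/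
open Matrix

/-- Smallest eigenvalue of a matrix, as the infimum of its set of (real) eigenvalues. -/
noncomputable def muMin {N : ℕ} (M : Matrix (Fin N) (Fin N) ℝ) : ℝ :=
  sInf {t : ℝ | ∃ v : Fin N → ℝ, v ≠ 0 ∧ M.mulVec v = t • v}

theorem dotProduct_mul_transpose_mulVec {N : ℕ} (A : Matrix (Fin N) (Fin N) ℝ) (v : Fin N → ℝ) :
    v ⬝ᵥ ((A * Aᵀ) *ᵥ v) = (v ᵥ* A) ⬝ᵥ (v ᵥ* A) := by
  rw [← mulVec_mulVec, dotProduct_mulVec, mulVec_transpose]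

theorem frobSq_eq_sum_dotProduct {m n : ℕ} (A : Matrix (Fin m) (Fin n) ℝ) :
    frobSq A = ∑ i, A i ⬝ᵥ A i := by
  simp only [frobSq, dotProduct, sq]

theorem frobSq_mul_sub_self {d N : ℕ} (Z : Matrix (Fin d) (Fin N) ℝ)
    (C : Matrix (Fin N) (Fin N) ℝ) :
    frobSq (Z * C - Z) = ∑ i, Z i ⬝ᵥ (((C - 1) * (C - 1)ᵀ) *ᵥ Z i) := by
  have h : Z * C - Z = Z * (C - 1) := by rw [Matrix.mul_sub, Matrix.mul_one]
  rw [h, frobSq_eq_sum_dotProduct]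
  refine Finset.sum_congr rfl fun i _ => ?_
  rw [dotProduct_mul_transpose_mulVec]
  rfl

theorem dotProduct_self_pos_of_ne_zero {N : ℕ} {v : Fin N → ℝ} (hv : v ≠ 0) : 0 < v ⬝ᵥ v :=
  lt_of_le_of_ne (Finset.sum_nonneg fun i _ => mul_self_nonneg (v i))
    fun h => hv (dotProduct_self_eq_zero.mp h.symm)

theorem eigenvalue_mul_transpose_nonneg {N : ℕ} (A : Matrix (Fin N) (Fin N) ℝ) {t : ℝ}
    {v : Fin N → ℝ} (hv : v ≠ 0) (h : (A * Aᵀ) *ᵥ v = t • v) : 0 ≤ t := by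
  have h1 := dotProduct_mul_transpose_mulVec A v
  rw [h, dotProduct_smul, smul_eq_mul] at h1
  have h2 : 0 ≤ (v ᵥ* A) ⬝ᵥ (v ᵥ* A) := Finset.sum_nonneg fun i _ => mul_self_nonneg _
  exact nonneg_of_mul_nonneg_left (h1 ▸ h2) (dotProduct_self_pos_of_ne_zero hv)

theorem bddBelow_eigenvalues_mul_transpose {N : ℕ} (A : Matrix (Fin N) (Fin N) ℝ) :
    BddBelow {t : ℝ | ∃ v : Fin N → ℝ, v ≠ 0 ∧ (A * Aᵀ) *ᵥ v = t • v} :=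
  ⟨0, fun _ ⟨_, hv, h⟩ => eigenvalue_mul_transpose_nonneg A hv h⟩

theorem isHermitian_mul_transpose {N : ℕ} (A : Matrix (Fin N) (Fin N) ℝ) :
    (A * Aᵀ).IsHermitian := by
  rw [← conjTranspose_eq_transpose_of_trivial]
  exact isHermitian_mul_conjTranspose_self A

theorem exists_mulVec_eq_eigenvalue_smul {N : ℕ} {M : Matrix (Fin N) (Fin N) ℝ}
    (hM : M.IsHermitian) (i : Fin N) :
    ∃ v : Fin N → ℝ, v ≠ 0 ∧ M *ᵥ v = hM.eigenvalues i • v := by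
  refine ⟨⇑(hM.eigenvectorBasis i), fun h => ?_, hM.mulVec_eigenvectorBasis i⟩
  exact hM.eigenvectorBasis.orthonormal.ne_zero i (by ext j; exact congrFun h j)

theorem exists_mulVec_eq_muMin_smul {N : ℕ} (hN : 0 < N) {M : Matrix (Fin N) (Fin N) ℝ}
    (hM : M.IsHermitian) : ∃ v : Fin N → ℝ, v ≠ 0 ∧ M *ᵥ v = muMin M • v := by
  have hne : {t : ℝ | ∃ v : Fin N → ℝ, v ≠ 0 ∧ M *ᵥ v = t • v}.Nonempty :=
    ⟨_, exists_mulVec_eq_eigenvalue_smul hM ⟨0, hN⟩⟩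
  refine hne.csInf_mem ((Module.End.finite_hasEigenvalue (Matrix.toLin' M)).subset ?_)
  rintro t ⟨v, hv, h⟩
  exact Module.End.hasEigenvalue_of_hasEigenvector
    (Module.End.hasEigenvector_iff.mpr ⟨Module.End.mem_eigenspace_iff.mpr (by simpa using h), hv⟩)

theorem muMin_mul_dotProduct_le {N : ℕ} (A : Matrix (Fin N) (Fin N) ℝ) (v : Fin N → ℝ) :
    muMin (A * Aᵀ) * (v ⬝ᵥ v) ≤ v ⬝ᵥ ((A * Aᵀ) *ᵥ v) := by
  have hH : (A * Aᵀ - muMin (A * Aᵀ) • (1 : Matrix (Fin N) (Fin N) ℝ)).IsHermitian :=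
    (isHermitian_mul_transpose A).sub (by simp [Matrix.IsHermitian])
  have hpsd := hH.posSemidef_iff_eigenvalues_nonneg.mpr fun i => by
    obtain ⟨w, hw, h⟩ := exists_mulVec_eq_eigenvalue_smul hH i
    rw [sub_mulVec, smul_mulVec, one_mulVec, sub_eq_iff_eq_add, ← add_smul] at h
    have hle : muMin (A * Aᵀ) ≤ hH.eigenvalues i + muMin (A * Aᵀ) :=
      csInf_le (bddBelow_eigenvalues_mul_transpose A) ⟨w, hw, h⟩
    simpa using hle
  have h := hpsd.dotProduct_mulVec_nonneg v
  rw [sub_mulVec, smul_mulVec, one_mulVec, dotProduct_sub, dotProduct_smul, smul_eq_mul,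
    star_trivial] at h
  linarith

theorem muMin_mul_transpose_nonneg {N : ℕ} (A : Matrix (Fin N) (Fin N) ℝ) :
    0 ≤ muMin (A * Aᵀ) :=
  Real.sInf_nonneg fun _ ⟨_, hv, h⟩ => eigenvalue_mul_transpose_nonneg A hv h

theorem muMin_mul_frobSq_le {d N : ℕ} (Z : Matrix (Fin d) (Fin N) ℝ)
    (C : Matrix (Fin N) (Fin N) ℝ) :
    muMin ((C - 1) * (C - 1)ᵀ) * frobSq Z ≤ frobSq (Z * C - Z) := by
  rw [frobSq_mul_sub_self, frobSq_eq_sum_dotProduct, Finset.mul_sum]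
  exact Finset.sum_le_sum fun i _ => muMin_mul_dotProduct_le _ _

theorem exists_frobSq_eq_and_frobSq_mul_sub_self_eq {d N : ℕ} (hd : 0 < d) (hN : 0 < N)
    {τ : ℝ} (hτ : 0 < τ) (C : Matrix (Fin N) (Fin N) ℝ) :
    ∃ Z : Matrix (Fin d) (Fin N) ℝ, frobSq Z = τ ∧
      frobSq (Z * C - Z) = τ * muMin ((C - 1) * (C - 1)ᵀ) := by
  obtain ⟨v, hv, h⟩ := exists_mulVec_eq_muMin_smul hN (isHermitian_mul_transpose (C - 1))
  have hpos := dotProduct_self_pos_of_ne_zero hv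
  have hs : √(τ / (v ⬝ᵥ v)) * √(τ / (v ⬝ᵥ v)) * (v ⬝ᵥ v) = τ := by
    rw [Real.mul_self_sqrt (by positivity), div_mul_cancel₀ _ hpos.ne']
  set c := √(τ / (v ⬝ᵥ v))
  let Z : Matrix (Fin d) (Fin N) ℝ := fun i => if i = ⟨0, hd⟩ then c • v else 0
  have hZ0 : Z ⟨0, hd⟩ = c • v := if_pos rfl
  have hZ : ∀ i, i ≠ ⟨0, hd⟩ → Z i = 0 := fun i hi => if_neg hi
  refine ⟨Z, ?_, ?_⟩
  · rw [frobSq_eq_sum_dotProduct, Finset.sum_eq_single ⟨0, hd⟩ (fun i _ hi => by simp [hZ i hi])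
      (by simp), hZ0, smul_dotProduct, dotProduct_smul, smul_eq_mul, smul_eq_mul, ← mul_assoc, hs]
  · rw [frobSq_mul_sub_self, Finset.sum_eq_single ⟨0, hd⟩ (fun i _ hi => by simp [hZ i hi])
      (by simp), hZ0, mulVec_smul, h, smul_dotProduct, dotProduct_smul, dotProduct_smul]
    simp only [smul_eq_mul]
    linear_combination muMin ((C - 1) * (C - 1)ᵀ) * hs

theorem stmt2 (d N : ℕ) (hd : 0 < d) (hN : 0 < N) (τ lam : ℝ) (hτ : 0 < τ) (hlam : 0 < lam)
    (θ : Matrix (Fin N) (Fin N) ℝ → ℝ) (hθ : BddBelow (Set.range θ)) :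
    sInf {y : ℝ | ∃ (C : Matrix (Fin N) (Fin N) ℝ) (Z : Matrix (Fin d) (Fin N) ℝ),
        τ ≤ frobSq Z ∧ y = (1 / 2) * frobSq (Z * C - Z) + lam * θ C} =
    sInf {y : ℝ | ∃ C : Matrix (Fin N) (Fin N) ℝ,
        y = (τ / 2) * muMin ((C - 1) * (C - 1)ᵀ) + lam * θ C} := by
  obtain ⟨b, hb⟩ := hθ
  have hbound : ∀ C, lam * b ≤ lam * θ C := fun C =>
    mul_le_mul_of_nonneg_left (hb ⟨C, rfl⟩) hlam.le
  have hsub : {y : ℝ | ∃ C : Matrix (Fin N) (Fin N) ℝ,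
      y = (τ / 2) * muMin ((C - 1) * (C - 1)ᵀ) + lam * θ C} ⊆
      {y : ℝ | ∃ (C : Matrix (Fin N) (Fin N) ℝ) (Z : Matrix (Fin d) (Fin N) ℝ),
        τ ≤ frobSq Z ∧ y = (1 / 2) * frobSq (Z * C - Z) + lam * θ C} := by
    rintro y ⟨C, rfl⟩
    obtain ⟨Z, hZ, hZC⟩ := exists_frobSq_eq_and_frobSq_mul_sub_self_eq hd hN hτ C
    exact ⟨C, Z, hZ.ge, by rw [hZC]; ring⟩
  have hne : {y : ℝ | ∃ C : Matrix (Fin N) (Fin N) ℝ,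
      y = (τ / 2) * muMin ((C - 1) * (C - 1)ᵀ) + lam * θ C}.Nonempty := ⟨_, 0, rfl⟩
  apply le_antisymm
  · refine csInf_le_csInf ⟨lam * b, ?_⟩ hne hsub
    rintro y ⟨C, Z, -, rfl⟩
    have hZ : 0 ≤ frobSq (Z * C - Z) :=
      Finset.sum_nonneg fun i _ => Finset.sum_nonneg fun j _ => sq_nonneg _
    linarith [hbound C]
  · refine le_csInf (hne.mono hsub) ?_
    rintro y ⟨C, Z, hZ, rfl⟩
    refine le_trans (csInf_le ⟨lam * b, ?_⟩ ⟨C, rfl⟩) ?_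
    · rintro y ⟨C, rfl⟩
      have hnonneg := mul_nonneg (half_pos hτ).le (muMin_mul_transpose_nonneg (C - 1))
      linarith [hbound C]
    · have hle := mul_le_mul_of_nonneg_left hZ (muMin_mul_transpose_nonneg (C - 1))
      linarith [muMin_mul_frobSq_le Z C]
end

section
/- Let C ∈ ℝ^{N×N} have all diagonal entries equal to zero, and let q ∈ ℝ^N be a nonzero vector satisfying qᵀC = qᵀ. Let i₀ be any index achieving a = max_i |q_i|, and let b = max_{j ≠ i₀} |q_j| (so b > 0). Then ‖C‖₁ ≥ a/b + (‖q‖₁ − a)/a, where ‖q‖₁ = Σ_i |q_i|. -/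
open Matrix

/-- If `q` is fixed by `C` and is bounded by `M` on the off-diagonal indices of column `j`, where `C`
vanishes on the diagonal, then the absolute column sum is at least `|q j| / M`. -/
theorem abs_div_le_sum_abs_col {ι : Type*} [Fintype ι] {C : Matrix ι ι ℝ} {q : ι → ℝ}
    (hfix : Matrix.vecMul q C = q) {j : ι} (hdiag : C j j = 0) {M : ℝ} (hM : 0 ≤ M)
    (hqM : ∀ i, i ≠ j → |q i| ≤ M) : |q j| / M ≤ ∑ i, |C i j| := by
  refine div_le_of_le_mul₀ hM (Finset.sum_nonneg fun i _ => abs_nonneg _) ?_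
  calc |q j| = |∑ i, q i * C i j| := by
        conv_lhs => rw [← hfix]
        rfl
    _ ≤ ∑ i, |q i * C i j| := Finset.abs_sum_le_sum_abs _ _
    _ ≤ ∑ i, |C i j| * M := Finset.sum_le_sum fun i _ => by
        rw [abs_mul, mul_comm]
        by_cases h : i = j
        · simp [h, hdiag]
        · exact mul_le_mul_of_nonneg_left (hqM i h) (abs_nonneg _)
    _ = (∑ i, |C i j|) * M := by rw [Finset.sum_mul]

theorem stmt6 (N : ℕ) (C : Matrix (Fin N) (Fin N) ℝ) (hdiag : ∀ i, C i i = 0)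
    (q : Fin N → ℝ) (hq : q ≠ 0) (hfix : Matrix.vecMul q C = q)
    (i0 : Fin N) (hmax : ∀ i, |q i| ≤ |q i0|)
    (b : ℝ) (hb : IsGreatest {x : ℝ | ∃ j, j ≠ i0 ∧ x = |q j|} b) :
    |q i0| / b + ((∑ i, |q i|) - |q i0|) / |q i0| ≤ l1 C := by
  have hb0 : 0 ≤ b := by
    obtain ⟨j, -, rfl⟩ := hb.1
    exact abs_nonneg _
  have hrest : (∑ i, |q i|) - |q i0| = ∑ j ∈ Finset.univ.erase i0, |q j| := by
    rw [← Finset.add_sum_erase _ _ (Finset.mem_univ i0), add_sub_cancel_left]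
  rw [hrest, Finset.sum_div, l1, Finset.sum_comm,
    ← Finset.add_sum_erase _ _ (Finset.mem_univ i0)]
  exact add_le_add
    (abs_div_le_sum_abs_col hfix (hdiag i0) hb0 fun i hi => hb.2 ⟨i, hi, rfl⟩)
    (Finset.sum_le_sum fun j _ =>
      abs_div_le_sum_abs_col hfix (hdiag j) (abs_nonneg _) fun i _ => hmax i)
end

section
/- Let C ∈ ℝ^{N×N} have all diagonal entries equal to zero, and suppose there exists a nonzero vector q ∈ ℝ^N satisfying qᵀC = qᵀ. Then ‖C‖₁ ≥ 2. -/
open Matrix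

/-- If `q` is a left fixed vector of a matrix with zero diagonal, then `|q j|` is at most the `j`-th
absolute column sum times any bound on the remaining entries of `q`. -/
lemma abs_le_mul_colSum_of_vecMul_eq_self {ι : Type*} [Fintype ι] {C : Matrix ι ι ℝ}
    (hdiag : ∀ i, C i i = 0) {q : ι → ℝ} (hfix : Matrix.vecMul q C = q) (j : ι) {M : ℝ}
    (hM : ∀ k, k ≠ j → |q k| ≤ M) : |q j| ≤ M * ∑ k, |C k j| := by
  have hj : q j = ∑ k, q k * C k j := (congrFun hfix j).symm
  rw [hj, Finset.mul_sum]
  refine (Finset.abs_sum_le_sum_abs _ _).trans (Finset.sum_le_sum fun k _ => ?_)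
  rw [abs_mul]
  rcases eq_or_ne k j with rfl | hk
  · simp [hdiag]
  · exact mul_le_mul_of_nonneg_right (hM k hk) (abs_nonneg _)

theorem stmt7 (N : ℕ) (C : Matrix (Fin N) (Fin N) ℝ) (hdiag : ∀ i, C i i = 0)
    (q : Fin N → ℝ) (hq : q ≠ 0) (hfix : Matrix.vecMul q C = q) :
    2 ≤ l1 C := by
  obtain ⟨l, hl⟩ := Function.ne_iff.mp hq
  obtain ⟨i, -, hi⟩ := Finset.exists_max_image Finset.univ (fun k => |q k|) ⟨l, Finset.mem_univ l⟩
  have hi_pos : 0 < |q i| := (abs_pos.mpr hl).trans_le (hi l (Finset.mem_univ l))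
  have hne : (Finset.univ.erase i).Nonempty := by
    by_contra h
    rw [Finset.not_nonempty_iff_eq_empty] at h
    have hle := abs_le_mul_colSum_of_vecMul_eq_self hdiag hfix i (M := 0) fun k hk =>
      absurd (Finset.mem_erase.mpr ⟨hk, Finset.mem_univ k⟩) (by simp [h])
    linarith
  obtain ⟨j, hj_mem, hj⟩ := Finset.exists_max_image _ (fun k => |q k|) hne
  have hji : j ≠ i := Finset.ne_of_mem_erase hj_mem
  have hcol_i := abs_le_mul_colSum_of_vecMul_eq_self hdiag hfix i (M := |q j|) fun k hk =>
    hj k (Finset.mem_erase.mpr ⟨hk, Finset.mem_univ k⟩)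
  have hcol_j := abs_le_mul_colSum_of_vecMul_eq_self hdiag hfix j (M := |q i|) fun k _ =>
    hi k (Finset.mem_univ k)
  have hj_pos : 0 < |q j| := by
    refine (abs_nonneg _).lt_of_ne fun h => ?_
    rw [← h, zero_mul] at hcol_i
    linarith
  have hsum : ∑ k, |C k i| + ∑ k, |C k j| ≤ l1 C := by
    rw [l1, Finset.sum_comm, ← Finset.sum_pair (f := fun c => ∑ k, |C k c|) hji.symm]
    exact Finset.sum_le_sum_of_subset_of_nonneg (Finset.subset_univ _) fun c _ _ =>
      Finset.sum_nonneg fun k _ => abs_nonneg _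
  have hratio_i : |q i| / |q j| ≤ ∑ k, |C k i| := (div_le_iff₀' hj_pos).mpr hcol_i
  have hratio_j : |q j| / |q i| ≤ ∑ k, |C k j| := (div_le_iff₀' hi_pos).mpr hcol_j
  have hamgm : 2 ≤ |q i| / |q j| + |q j| / |q i| := by
    rw [div_add_div _ _ hj_pos.ne' hi_pos.ne', le_div_iff₀ (mul_pos hj_pos hi_pos)]
    nlinarith [sq_nonneg (|q i| - |q j|)]
  linarith
end

section
/- For a nonzero vector q ∈ ℝ^N, define m(q) as the infimum of ‖C‖₁ over all C ∈ ℝ^{N×N} with zero diagonal satisfying qᵀC = qᵀ (with m(q) = +∞ if no such C exists). Then m(q) = 2 if q has exactly two nonzero entries and these two entries have equal absolute value, and m(q) > 2 otherwise. -/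
open Matrix

/-- `mval q` is the infimum (in the extended reals, so `⊤` if infeasible) of the entrywise
ℓ1 norm of `C` over all zero-diagonal matrices `C` with `qᵀ C = qᵀ`. -/
noncomputable def mval {N : ℕ} (q : Fin N → ℝ) : EReal :=
  sInf {x : EReal | ∃ C : Matrix (Fin N) (Fin N) ℝ,
    (∀ i, C i i = 0) ∧ Matrix.vecMul q C = q ∧ x = (l1 C : ℝ)}

/-- Column `j` of a feasible matrix must have enough `ℓ1` mass to reproduce `q j` from the other
entries of `q`. -/
lemma abs_le_mul_column_sum {N : ℕ} {q : Fin N → ℝ} {C : Matrix (Fin N) (Fin N) ℝ}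
    (hdiag : ∀ i, C i i = 0) (hqC : Matrix.vecMul q C = q) (j : Fin N) {B : ℝ}
    (hB : ∀ i, i ≠ j → |q i| ≤ B) : |q j| ≤ B * ∑ i, |C i j| := by
  have hj : q j = ∑ i, q i * C i j := by
    conv_lhs => rw [← hqC]
    rfl
  rw [hj, Finset.mul_sum]
  refine (Finset.abs_sum_le_sum_abs _ _).trans (Finset.sum_le_sum fun i _ => ?_)
  rw [abs_mul]
  by_cases hij : i = j
  · simp [hij, hdiag]
  · exact mul_le_mul_of_nonneg_right (hB i hij) (abs_nonneg _)

/-- Lower bound on the `ℓ1` norm of a feasible matrix, where `a` is a position of largest magnitude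
in `q` and `P` bounds the remaining magnitudes. -/
lemma div_add_sum_div_le_l1 {N : ℕ} {q : Fin N → ℝ} {C : Matrix (Fin N) (Fin N) ℝ}
    (hdiag : ∀ i, C i i = 0) (hqC : Matrix.vecMul q C = q) {a : Fin N} {P : ℝ}
    (ha : 0 < |q a|) (hP : 0 < P) (hmax : ∀ i, |q i| ≤ |q a|) (hrest : ∀ i, i ≠ a → |q i| ≤ P) :
    |q a| / P + ∑ j ∈ Finset.univ.erase a, |q j| / |q a| ≤ l1 C := by
  rw [l1, Finset.sum_comm, ← Finset.add_sum_erase _ _ (Finset.mem_univ a)]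
  refine add_le_add ?_ (Finset.sum_le_sum fun j _ => ?_)
  · rw [div_le_iff₀' hP]
    exact abs_le_mul_column_sum hdiag hqC a hrest
  · rw [div_le_iff₀' ha]
    exact abs_le_mul_column_sum hdiag hqC j fun i _ => hmax i

/-- A uniform lower bound on feasible `ℓ1` norms bounds `mval`. -/
lemma le_mval {N : ℕ} {q : Fin N → ℝ} {L : ℝ}
    (h : ∀ C : Matrix (Fin N) (Fin N) ℝ, (∀ i, C i i = 0) → Matrix.vecMul q C = q → L ≤ l1 C) :
    (L : EReal) ≤ mval q := by
  refine le_sInf ?_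
  rintro x ⟨C, hdiag, hqC, rfl⟩
  exact EReal.coe_le_coe_iff.mpr (h C hdiag hqC)

lemma mval_eq_two {N : ℕ} {q : Fin N → ℝ} {i j : Fin N} (hij : i ≠ j) (hi : q i ≠ 0)
    (hj : q j ≠ 0) (habs : |q i| = |q j|) (hzero : ∀ k, k ≠ i → k ≠ j → q k = 0) :
    mval q = 2 := by
  have hi' : 0 < |q i| := abs_pos.mpr hi
  apply le_antisymm
  · refine sInf_le ⟨Matrix.single i j (q j / q i) + Matrix.single j i (q i / q j), ?_, ?_, ?_⟩
    · intro k
      simp only [Matrix.add_apply, Matrix.single_apply]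
      grind
    · ext k
      rw [Matrix.vecMul_add]
      simp only [Pi.add_apply, Matrix.vecMul, dotProduct, Matrix.single_apply]
      by_cases hki : k = i
      · subst hki
        simp [hij.symm, mul_div_cancel₀ _ hj]
      · by_cases hkj : k = j
        · subst hkj
          simp [hij, mul_div_cancel₀ _ hi]
        · simp [Ne.symm hki, Ne.symm hkj, hzero k hki hkj]
    · have hentry : ∀ r c, |(Matrix.single i j (q j / q i) + Matrix.single j i (q i / q j)) r c| =
          (if i = r then if j = c then (1 : ℝ) else 0 else 0) +
            (if j = r then if i = c then (1 : ℝ) else 0 else 0) := by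
        intro r c
        have h₁ : |q j / q i| = 1 := by rw [abs_div, habs, div_self (abs_ne_zero.mpr hj)]
        have h₂ : |q i / q j| = 1 := by rw [abs_div, habs, div_self (abs_ne_zero.mpr hj)]
        simp only [Matrix.add_apply, Matrix.single_apply]
        by_cases hr : i = r
        · have hr' : j ≠ r := fun h => hij (hr.trans h.symm)
          by_cases hc : j = c <;> simp [hr, hr', hc] <;> grind
        · by_cases hr' : j = r <;> by_cases hc : i = c <;> simp [hr, hr', hc] <;> grind
      have hl1 : l1 (Matrix.single i j (q j / q i) + Matrix.single j i (q i / q j)) = 2 := by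
        simp only [l1, hentry, Finset.sum_add_distrib]
        rw [Finset.sum_eq_single i (fun b _ hb => by simp [hb.symm]) (by simp),
          Finset.sum_eq_single (f := fun r => ∑ c, if j = r then if i = c then (1 : ℝ) else 0 else 0)
            j (fun b _ hb => by simp [hb.symm]) (by simp)]
        norm_num
      rw [hl1]
      rfl
  · refine le_mval (L := 2) fun C hdiag hqC => ?_
    have hmax : ∀ k, |q k| ≤ |q i| := by
      intro k
      by_cases hki : k = i
      · rw [hki]
      · by_cases hkj : k = j
        · rw [hkj, habs]
        · simp [hzero k hki hkj]
    have hL := div_add_sum_div_le_l1 hdiag hqC hi' hi' hmax fun k _ => hmax k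
    have hsum : |q j| / |q i| ≤ ∑ k ∈ Finset.univ.erase i, |q k| / |q i| :=
      Finset.single_le_sum (f := fun k => |q k| / |q i|) (fun k _ => by positivity)
        (by simp [hij.symm])
    rw [← habs, div_self hi'.ne'] at hsum
    rw [div_self hi'.ne'] at hL
    linarith

lemma two_lt_mval {N : ℕ} {q : Fin N → ℝ} (hq : q ≠ 0)
    (h : ¬ ∃ i j, i ≠ j ∧ q i ≠ 0 ∧ q j ≠ 0 ∧ |q i| = |q j| ∧
      (∀ k, k ≠ i → k ≠ j → q k = 0)) : 2 < mval q := by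
  obtain ⟨i₀, hi₀⟩ := Function.ne_iff.mp hq
  obtain ⟨a, -, hmax⟩ :=
    Finset.exists_max_image Finset.univ (fun i => |q i|) ⟨i₀, Finset.mem_univ _⟩
  replace hmax : ∀ i, |q i| ≤ |q a| := fun i => hmax i (Finset.mem_univ i)
  have ha : 0 < |q a| := (abs_pos.mpr hi₀).trans_le (hmax i₀)
  suffices hL : ∃ L : ℝ, 2 < L ∧ ∀ C : Matrix (Fin N) (Fin N) ℝ,
      (∀ i, C i i = 0) → Matrix.vecMul q C = q → L ≤ l1 C by
    obtain ⟨L, hL2, hL⟩ := hL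
    exact lt_of_lt_of_le (EReal.coe_lt_coe_iff.mpr hL2) (le_mval hL)
  by_cases hall : ∀ k, k ≠ a → q k = 0
  · refine ⟨3, by norm_num, fun C hdiag hqC => ?_⟩
    have := abs_le_mul_column_sum hdiag hqC a (B := 0) fun i hi => by simp [hall i hi]
    linarith
  push Not at hall
  obtain ⟨k₀, hk₀a, hk₀⟩ := hall
  obtain ⟨b, hb, hbmax⟩ := Finset.exists_max_image (Finset.univ.erase a) (fun i => |q i|)
    ⟨k₀, by simp [hk₀a]⟩
  have hba : b ≠ a := Finset.ne_of_mem_erase hb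
  replace hbmax : ∀ i, i ≠ a → |q i| ≤ |q b| := fun i hi => hbmax i (by simp [hi])
  have hbpos : 0 < |q b| := (abs_pos.mpr hk₀).trans_le (hbmax k₀ hk₀a)
  refine ⟨_, ?_, fun C hdiag hqC => div_add_sum_div_le_l1 hdiag hqC ha hbpos hmax hbmax⟩
  rw [← Finset.add_sum_erase _ _ hb]
  have hrest : 0 ≤ ∑ k ∈ (Finset.univ.erase a).erase b, |q k| / |q a| :=
    Finset.sum_nonneg fun k _ => by positivity
  have hsq : |q a| / |q b| + |q b| / |q a| = 2 + (|q a| - |q b|) ^ 2 / (|q a| * |q b|) := by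
    field_simp
    ring
  by_cases hab : |q a| = |q b|
  · have hex : ∃ k, k ≠ a ∧ k ≠ b ∧ q k ≠ 0 := by
      by_contra! hno
      exact h ⟨a, b, hba.symm, abs_pos.mp ha, abs_pos.mp hbpos, hab, hno⟩
    obtain ⟨k, hka, hkb, hk⟩ := hex
    have hpos : 0 < ∑ k ∈ (Finset.univ.erase a).erase b, |q k| / |q a| :=
      Finset.sum_pos' (fun k _ => by positivity)
        ⟨k, by simp [hka, hkb], div_pos (abs_pos.mpr hk) ha⟩
    have : 0 ≤ (|q a| - |q b|) ^ 2 / (|q a| * |q b|) := by positivity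
    linarith
  · have hne : |q a| - |q b| ≠ 0 := sub_ne_zero.mpr hab
    have : 0 < (|q a| - |q b|) ^ 2 / (|q a| * |q b|) := by positivity
    linarith

theorem stmt8 (N : ℕ) (q : Fin N → ℝ) (hq : q ≠ 0) :
    ((∃ i j, i ≠ j ∧ q i ≠ 0 ∧ q j ≠ 0 ∧ |q i| = |q j| ∧
        (∀ k, k ≠ i → k ≠ j → q k = 0)) → mval q = 2) ∧
    ((¬ ∃ i j, i ≠ j ∧ q i ≠ 0 ∧ q j ≠ 0 ∧ |q i| = |q j| ∧
        (∀ k, k ≠ i → k ≠ j → q k = 0)) → 2 < mval q) := by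
  refine ⟨?_, two_lt_mval hq⟩
  rintro ⟨i, j, hij, hi, hj, habs, hzero⟩
  exact mval_eq_two hij hi hj habs hzero
end

section
/- Let d, N ≥ 2 and τ > 0. Consider the problem of minimizing ‖C‖₁ over all pairs (Z, C) with Z ∈ ℝ^{d×N}, C ∈ ℝ^{N×N}, subject to: all diagonal entries of C are zero, Z = ZC, and ‖Z‖_F² ≥ τ. The optimal value is 2, and a feasible pair (Z, C) is optimal if and only if there exist distinct indices i ≠ j, a sign s ∈ {−1, 1}, and a vector z ∈ ℝ^d with ‖z‖² ≥ τ/2 such that: column Z_i = z, column Z_j = s·z, all other columns of Z are zero, C_{i,j} = C_{j,i} = s, and all other entries of C are zero. -/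
open Matrix

/-- The entrywise ℓ1 norm is the sum of the ℓ1 norms of the columns. -/
theorem l1_eq_sum_columns {m n : ℕ} (A : Matrix (Fin m) (Fin n) ℝ) :
    l1 A = ∑ j, ∑ i, |A i j| :=
  Finset.sum_comm

/-- A matrix supported on a symmetric pair of off-diagonal entries of modulus one has
entrywise ℓ1 norm two. -/
theorem l1_eq_two_of_swap_support {n : ℕ} {C : Matrix (Fin n) (Fin n) ℝ} {i j : Fin n}
    (hij : i ≠ j) (hCij : |C i j| = 1) (hCji : |C j i| = 1)
    (hC : ∀ a b, ¬(a = i ∧ b = j) → ¬(a = j ∧ b = i) → C a b = 0) : l1 C = 2 := by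
  have habs : ∀ a b, |C a b| =
      (if a = i then if b = j then (1 : ℝ) else 0 else 0) +
        (if a = j then if b = i then (1 : ℝ) else 0 else 0) := by
    intro a b
    by_cases h₁ : a = i ∧ b = j
    · obtain ⟨rfl, rfl⟩ := h₁
      simp [hij, hCij]
    · by_cases h₂ : a = j ∧ b = i
      · obtain ⟨rfl, rfl⟩ := h₂
        simp [hij.symm, hCji]
      · rw [hC a b h₁ h₂, ← ite_and, ← ite_and, if_neg h₁, if_neg h₂]
        simp
  simp only [l1, habs, Finset.sum_add_distrib]
  simp [Finset.sum_ite_irrel]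
  norm_num

/-- For a nonzero left fixed vector of a matrix with zero diagonal, the two coordinates of largest
modulus control the ℓ1 norms of the corresponding columns. -/
theorem exists_dominant_pair {n : ℕ} (hn : 2 ≤ n) {C : Matrix (Fin n) (Fin n) ℝ}
    (hdiag : ∀ i, C i i = 0) {x : Fin n → ℝ} (hx : x ≠ 0)
    (hfix : ∀ j, x j = ∑ k, x k * C k j) :
    ∃ i j, i ≠ j ∧ 0 < |x i| ∧ 0 < |x j| ∧
      |x i| ≤ |x j| * ∑ k, |C k i| ∧ |x j| ≤ |x i| * ∑ k, |C k j| := by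
  have : Nontrivial (Fin n) := Fin.nontrivial_iff_two_le.mpr hn
  have hcol : ∀ l, ∀ B, (∀ k, k ≠ l → |x k| ≤ B) → |x l| ≤ B * ∑ k, |C k l| := by
    intro l B hB
    calc |x l| = |∑ k, x k * C k l| := by rw [← hfix l]
      _ ≤ ∑ k, |x k * C k l| := Finset.abs_sum_le_sum_abs _ _
      _ ≤ ∑ k, B * |C k l| := by
        refine Finset.sum_le_sum fun k _ => ?_
        rw [abs_mul]
        by_cases hk : k = l
        · simp [hk, hdiag]
        · exact mul_le_mul_of_nonneg_right (hB k hk) (abs_nonneg _)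
      _ = B * ∑ k, |C k l| := by rw [Finset.mul_sum]
  obtain ⟨i, -, hi⟩ := Finset.exists_max_image Finset.univ (fun k => |x k|) Finset.univ_nonempty
  obtain ⟨m, hm⟩ := exists_ne i
  obtain ⟨j, hj, hjmax⟩ := Finset.exists_max_image (Finset.univ.erase i) (fun k => |x k|)
    ⟨m, by simp [hm]⟩
  have hji : j ≠ i := Finset.ne_of_mem_erase hj
  obtain ⟨k, hk⟩ := Function.ne_iff.mp hx
  have hipos : 0 < |x i| := (abs_pos.mpr hk).trans_le (hi k (Finset.mem_univ k))
  have hci := hcol i |x j| fun k hk => hjmax k (by simp [hk])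
  have hcj := hcol j |x i| fun k _ => hi k (Finset.mem_univ k)
  refine ⟨i, j, hji.symm, hipos, ?_, hci, hcj⟩
  rcases (abs_nonneg (x j)).lt_or_eq with h | h
  · exact h
  · rw [← h, zero_mul] at hci
    exact absurd hci hipos.not_ge

/-- If `p ≤ q * a` and `q ≤ p * b` with `p, q > 0`, then `a + b ≥ 2`. -/
theorem two_le_add_of_le_mul {p q a b : ℝ} (hp : 0 < p) (hq : 0 < q)
    (ha : p ≤ q * a) (hb : q ≤ p * b) : 2 ≤ a + b := by
  have hpq : 0 < p * q := mul_pos hp hq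
  have h₁ := mul_le_mul_of_nonneg_left ha hp.le
  have h₂ := mul_le_mul_of_nonneg_left hb hq.le
  refine le_of_mul_le_mul_left ?_ hpq
  nlinarith [sq_nonneg (p - q)]

/-- If `p ≤ q * a` and `q ≤ p * b` with `p, q > 0` and `a + b ≤ 2`, then `a = b = 1`
and `p = q`. -/
theorem eq_one_of_le_mul_of_add_le_two {p q a b : ℝ} (hp : 0 < p) (hq : 0 < q)
    (ha : p ≤ q * a) (hb : q ≤ p * b) (hab : a + b ≤ 2) : p = q ∧ a = 1 ∧ b = 1 := by
  have hpq : 0 < p * q := mul_pos hp hq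
  have h₁ := mul_le_mul_of_nonneg_left ha hp.le
  have h₂ := mul_le_mul_of_nonneg_left hb hq.le
  have h₃ := mul_le_mul_of_nonneg_left hab hpq.le
  have h : p - q = 0 := pow_eq_zero_iff two_ne_zero |>.mp <|
    le_antisymm (by nlinarith) (sq_nonneg (p - q))
  obtain rfl : p = q := sub_eq_zero.mp h
  have ha' : 1 ≤ a := le_of_mul_le_mul_left (by linarith) hp
  have hb' : 1 ≤ b := le_of_mul_le_mul_left (by linarith) hp
  exact ⟨rfl, by linarith, by linarith⟩

/-- A zero-diagonal matrix with a nonzero left fixed vector has ℓ1 norm at least two. -/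
theorem two_le_l1_of_fixed {n : ℕ} (hn : 2 ≤ n) {C : Matrix (Fin n) (Fin n) ℝ}
    (hdiag : ∀ i, C i i = 0) {x : Fin n → ℝ} (hx : x ≠ 0)
    (hfix : ∀ j, x j = ∑ k, x k * C k j) : 2 ≤ l1 C := by
  obtain ⟨i, j, hij, hi, hj, hci, hcj⟩ := exists_dominant_pair hn hdiag hx hfix
  rw [l1_eq_sum_columns]
  calc (2 : ℝ) ≤ ∑ l ∈ {i, j}, ∑ k, |C k l| := by
        rw [Finset.sum_pair hij]
        exact two_le_add_of_le_mul hi hj hci hcj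
    _ ≤ ∑ l, ∑ k, |C k l| := Finset.sum_le_univ_sum_of_nonneg fun l =>
        Finset.sum_nonneg fun k _ => abs_nonneg _

/-- In a vector of ℓ1 norm one, an entry of modulus one is the only nonzero entry. -/
theorem eq_zero_of_sum_abs_eq_one {ι : Type*} [Fintype ι] {v : ι → ℝ}
    (hv : ∑ k, |v k| = 1) {i : ι} (hi : |v i| = 1) {k : ι} (hk : k ≠ i) : v k = 0 := by
  classical
  rw [← Finset.add_sum_erase _ _ (Finset.mem_univ i), hi, add_eq_left,
    Finset.sum_eq_zero_iff_of_nonneg fun _ _ => abs_nonneg _] at hv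
  exact abs_eq_zero.mp (hv k (by simp [hk]))

/-- A zero-diagonal matrix of ℓ1 norm two with a nonzero left fixed vector is a signed
transposition of two coordinates, extended by zero. -/
theorem exists_swap_of_l1_eq_two {n : ℕ} (hn : 2 ≤ n) {C : Matrix (Fin n) (Fin n) ℝ}
    (hdiag : ∀ i, C i i = 0) {x : Fin n → ℝ} (hx : x ≠ 0)
    (hfix : ∀ j, x j = ∑ k, x k * C k j) (hC : l1 C = 2) :
    ∃ (i j : Fin n) (s : ℝ), i ≠ j ∧ (s = 1 ∨ s = -1) ∧ C i j = s ∧ C j i = s ∧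
      ∀ a b, ¬(a = i ∧ b = j) → ¬(a = j ∧ b = i) → C a b = 0 := by
  obtain ⟨i, j, hij, hi, hj, hci, hcj⟩ := exists_dominant_pair hn hdiag hx hfix
  have hnonneg : ∀ l, 0 ≤ ∑ k, |C k l| := fun l => Finset.sum_nonneg fun k _ => abs_nonneg _
  rw [l1_eq_sum_columns, ← Finset.sum_add_sum_compl {i, j}, Finset.sum_pair hij] at hC
  have hrest : 0 ≤ ∑ l ∈ ({i, j} : Finset (Fin n))ᶜ, ∑ k, |C k l| :=
    Finset.sum_nonneg fun l _ => hnonneg l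
  obtain ⟨hxij, hcol_i, hcol_j⟩ :=
    eq_one_of_le_mul_of_add_le_two hi hj hci hcj (by linarith)
  have hrest_zero : ∑ l ∈ ({i, j} : Finset (Fin n))ᶜ, ∑ k, |C k l| = 0 := by linarith
  have hother : ∀ l, l ≠ i → l ≠ j → ∀ k, C k l = 0 := by
    intro l hli hlj k
    have h := (Finset.sum_eq_zero_iff_of_nonneg fun l _ => hnonneg l).mp hrest_zero l
      (by simp [hli, hlj])
    exact abs_eq_zero.mp
      ((Finset.sum_eq_zero_iff_of_nonneg fun _ _ => abs_nonneg _).mp h k (Finset.mem_univ k))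
  have hx_other : ∀ l, l ≠ i → l ≠ j → x l = 0 := by
    intro l hli hlj
    rw [hfix l]
    simp [hother l hli hlj]
  have hxi : x i = x j * C j i := by
    rw [hfix i]
    refine Finset.sum_eq_single j (fun k _ hk => ?_) (by simp)
    by_cases hki : k = i
    · simp [hki, hdiag]
    · simp [hx_other k hki hk]
  have hxj : x j = x i * C i j := by
    rw [hfix j]
    refine Finset.sum_eq_single i (fun k _ hk => ?_) (by simp)
    by_cases hkj : k = j
    · simp [hkj, hdiag]
    · simp [hx_other k hk hkj]
  have hCji : |C j i| = 1 := by
    have h := congrArg abs hxi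
    rw [abs_mul, hxij] at h
    exact mul_left_cancel₀ hj.ne' (by linarith)
  have hCij : |C i j| = 1 := by
    have h := congrArg abs hxj
    rw [abs_mul, hxij] at h
    exact mul_left_cancel₀ hj.ne' (by linarith)
  have hprod : C i j * C j i = 1 := by
    refine mul_left_cancel₀ (abs_pos.mp hi) ?_
    rw [← mul_assoc, ← hxj, ← hxi, mul_one]
  have hsign : C i j = 1 ∨ C i j = -1 := eq_or_eq_neg_of_abs_eq hCij
  refine ⟨i, j, C i j, hij, hsign, rfl, ?_, fun a b hab hba => ?_⟩
  · rcases hsign with h | h <;> rw [h] at hprod ⊢ <;> linarith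
  · by_cases hbi : b = i
    · subst hbi
      exact eq_zero_of_sum_abs_eq_one hcol_i hCji fun h => hba ⟨h, rfl⟩
    · by_cases hbj : b = j
      · subst hbj
        exact eq_zero_of_sum_abs_eq_one hcol_j hCij fun h => hab ⟨h, rfl⟩
      · exact hother b hbi hbj a

/-- A self-expressive matrix of positive Frobenius norm has a nonzero row fixed by the
coefficient matrix. -/
theorem exists_fixed_row {m n : ℕ} {Z : Matrix (Fin m) (Fin n) ℝ} {C : Matrix (Fin n) (Fin n) ℝ}
    (hZC : Z = Z * C) (hZ : 0 < frobSq Z) :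
    ∃ x : Fin n → ℝ, x ≠ 0 ∧ ∀ j, x j = ∑ k, x k * C k j := by
  obtain ⟨r, hr⟩ : ∃ r, Z r ≠ 0 := by
    by_contra! h
    simp [frobSq, h] at hZ
  exact ⟨Z r, hr, fun j => congrFun (congrFun hZC r) j⟩

/-- If only the columns `i` and `j` of `Z` are nonzero and they agree up to a sign, then the
squared Frobenius norm of `Z` is twice the squared norm of column `i`. -/
theorem frobSq_eq_two_mul_of_pair {m n : ℕ} {Z : Matrix (Fin m) (Fin n) ℝ} {i j : Fin n} {s : ℝ}
    (hij : i ≠ j) (hs : s = 1 ∨ s = -1) (hj : ∀ k, Z k j = s * Z k i)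
    (hZ : ∀ l, l ≠ i → l ≠ j → ∀ k, Z k l = 0) : frobSq Z = 2 * ∑ k, Z k i ^ 2 := by
  rw [frobSq, Finset.mul_sum]
  refine Finset.sum_congr rfl fun k _ => ?_
  rw [← Finset.sum_subset (Finset.subset_univ {i, j}) fun l _ hl => ?_, Finset.sum_pair hij, hj k]
  · rcases hs with rfl | rfl <;> ring
  · simp only [Finset.mem_insert, Finset.mem_singleton, not_or] at hl
    simp [hZ l hl.1 hl.2 k]

/-- For every `τ ≥ 0` there is a feasible pair of ℓ1 norm two. -/
theorem exists_feasible_l1_eq_two {m n : ℕ} (hm : 0 < m) (hn : 2 ≤ n) {τ : ℝ} (hτ : 0 ≤ τ) :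
    ∃ (Z : Matrix (Fin m) (Fin n) ℝ) (C : Matrix (Fin n) (Fin n) ℝ),
      (∀ i, C i i = 0) ∧ Z = Z * C ∧ τ ≤ frobSq Z ∧ l1 C = 2 := by
  have : Nontrivial (Fin n) := Fin.nontrivial_iff_two_le.mpr hn
  obtain ⟨i, j, hij⟩ := exists_pair_ne (Fin n)
  let Z : Matrix (Fin m) (Fin n) ℝ := Matrix.of fun _ l => if l = i ∨ l = j then √τ else 0
  let C : Matrix (Fin n) (Fin n) ℝ :=
    Matrix.of fun a b => if (a = i ∧ b = j) ∨ (a = j ∧ b = i) then 1 else 0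
  refine ⟨Z, C, fun a => if_neg ?_, ?_, ?_, ?_⟩
  · rintro (⟨rfl, h⟩ | ⟨rfl, h⟩)
    exacts [hij h, hij h.symm]
  · ext k l
    rw [Matrix.mul_apply]
    by_cases hli : l = i
    · subst hli
      rw [Finset.sum_eq_single j (fun a _ ha => by simp [C, ha, hij]) (by simp)]
      simp [Z, C]
    · by_cases hlj : l = j
      · subst hlj
        rw [Finset.sum_eq_single i (fun a _ ha => by simp [C, ha, hij.symm]) (by simp)]
        simp [Z, C]
      · simp [Z, C, hli, hlj]
  · rw [frobSq_eq_two_mul_of_pair (Z := Z) hij (Or.inl rfl) (by simp [Z])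
      fun l hli hlj k => by simp [Z, hli, hlj]]
    have hm' : (1 : ℝ) ≤ m := by exact_mod_cast hm
    simp only [Z, Matrix.of_apply, true_or, if_true, Real.sq_sqrt hτ, Finset.sum_const,
      Finset.card_univ, Fintype.card_fin, nsmul_eq_mul]
    nlinarith
  · exact l1_eq_two_of_swap_support hij (by simp [C]) (by simp [C])
      fun a b hab hba => if_neg (not_or.mpr ⟨hab, hba⟩)

theorem stmt9 (d N : ℕ) (hd : 2 ≤ d) (hN : 2 ≤ N) (τ : ℝ) (hτ : 0 < τ) :
    IsLeast {y : ℝ | ∃ (Z : Matrix (Fin d) (Fin N) ℝ) (C : Matrix (Fin N) (Fin N) ℝ),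
        (∀ i, C i i = 0) ∧ Z = Z * C ∧ τ ≤ frobSq Z ∧ y = l1 C} 2 ∧
    ∀ (Z : Matrix (Fin d) (Fin N) ℝ) (C : Matrix (Fin N) (Fin N) ℝ),
      (∀ i, C i i = 0) → Z = Z * C → τ ≤ frobSq Z →
      (l1 C = 2 ↔
        ∃ (i j : Fin N) (s : ℝ) (z : Fin d → ℝ),
          i ≠ j ∧ (s = 1 ∨ s = -1) ∧ τ / 2 ≤ ∑ k, z k ^ 2 ∧
          (∀ k, Z k i = z k) ∧ (∀ k, Z k j = s * z k) ∧
          (∀ l, l ≠ i → l ≠ j → ∀ k, Z k l = 0) ∧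
          C i j = s ∧ C j i = s ∧
          (∀ a b, ¬(a = i ∧ b = j) → ¬(a = j ∧ b = i) → C a b = 0)) := by
  refine ⟨⟨?_, ?_⟩, fun Z C hdiag hZC hZ => ⟨fun hC => ?_, ?_⟩⟩
  · obtain ⟨Z, C, hdiag, hZC, hZ, hC⟩ :=
      exists_feasible_l1_eq_two (m := d) (by omega) hN hτ.le
    exact ⟨Z, C, hdiag, hZC, hZ, hC.symm⟩
  · rintro y ⟨Z, C, hdiag, hZC, hZ, rfl⟩
    obtain ⟨x, hx, hfix⟩ := exists_fixed_row hZC (hτ.trans_le hZ)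
    exact two_le_l1_of_fixed hN hdiag hx hfix
  · obtain ⟨x, hx, hfix⟩ := exists_fixed_row hZC (hτ.trans_le hZ)
    obtain ⟨i, j, s, hij, hs, hCij, hCji, hC0⟩ :=
      exists_swap_of_l1_eq_two hN hdiag hx hfix hC
    have hZj : ∀ k, Z k j = s * Z k i := by
      intro k
      conv_lhs => rw [hZC]
      rw [Matrix.mul_apply, Finset.sum_eq_single i (fun a _ ha => ?_) (by simp), hCij, mul_comm]
      rw [hC0 a j (fun h => ha h.1) (fun h => hij h.2.symm), mul_zero]
    have hZ0 : ∀ l, l ≠ i → l ≠ j → ∀ k, Z k l = 0 := by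
      intro l hli hlj k
      rw [hZC, Matrix.mul_apply]
      refine Finset.sum_eq_zero fun a _ => ?_
      rw [hC0 a l (fun h => hlj h.2) (fun h => hli h.2), mul_zero]
    have hfrob := frobSq_eq_two_mul_of_pair hij hs hZj hZ0
    exact ⟨i, j, s, fun k => Z k i, hij, hs, by linarith, fun _ => rfl, hZj, hZ0,
      hCij, hCji, hC0⟩
  · rintro ⟨i, j, s, z, hij, hs, -, -, -, -, hCij, hCji, hC0⟩
    have habs : |s| = 1 := by rcases hs with rfl | rfl <;> simp
    exact l1_eq_two_of_swap_support hij (by rw [hCij, habs]) (by rw [hCji, habs]) hC0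
end

section
/- Let C ∈ ℝ^{N×N} and suppose there exists a nonzero vector q ∈ ℝ^N satisfying qᵀC = qᵀ. Then ‖C‖_F ≥ 1. Moreover, ‖C‖_F = 1 if and only if C = vvᵀ for some unit vector v ∈ ℝ^N (in which case q is a scalar multiple of v). -/
open Matrix

/-- Frobenius norm. -/
noncomputable def frobNorm {m n : ℕ} (A : Matrix (Fin m) (Fin n) ℝ) : ℝ :=
  Real.sqrt (∑ i, ∑ j, A i j ^ 2)

/-- If `v` is a unit vector fixed by `C` from the left, the squared Frobenius distance from `C` to
the projection `v vᵀ` is the squared Frobenius norm of `C` minus one. -/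
theorem sum_sq_sub_vecMulVec_self {ι : Type*} [Fintype ι] (C : Matrix ι ι ℝ) (v : ι → ℝ)
    (hv : ∑ i, v i ^ 2 = 1) (hfix : v ᵥ* C = v) :
    ∑ i, ∑ j, (C i j - v i * v j) ^ 2 = (∑ i, ∑ j, C i j ^ 2) - 1 := by
  have cross : ∑ i, ∑ j, v i * C i j * v j = 1 := by
    rw [Finset.sum_comm, ← hv]
    refine Finset.sum_congr rfl fun j _ => ?_
    rw [← Finset.sum_mul, sq]
    exact congrArg (· * v j) (congrFun hfix j)
  have square : ∑ i, ∑ j, v i ^ 2 * v j ^ 2 = 1 := by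
    simp_rw [← Finset.mul_sum, hv, mul_one, hv]
  have expand : ∀ i j, (C i j - v i * v j) ^ 2 =
      C i j ^ 2 - 2 * (v i * C i j * v j) + v i ^ 2 * v j ^ 2 := fun i j => by ring
  simp_rw [expand, Finset.sum_add_distrib, Finset.sum_sub_distrib, ← Finset.mul_sum _ _ (2 : ℝ)]
  rw [cross, square]
  ring

theorem stmt11 (N : ℕ) (C : Matrix (Fin N) (Fin N) ℝ)
    (q : Fin N → ℝ) (hq : q ≠ 0) (hfix : Matrix.vecMul q C = q) :
    1 ≤ frobNorm C ∧
    (frobNorm C = 1 ↔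
      ∃ v : Fin N → ℝ, (∑ i, v i ^ 2) = 1 ∧ C = Matrix.vecMulVec v v ∧
        ∃ c : ℝ, q = c • v) := by
  obtain ⟨i₀, hi₀⟩ := Function.ne_iff.mp hq
  have hpos : 0 < ∑ i, q i ^ 2 :=
    Finset.sum_pos' (fun i _ => sq_nonneg _) ⟨i₀, Finset.mem_univ _, sq_pos_of_ne_zero hi₀⟩
  set r := Real.sqrt (∑ i, q i ^ 2)
  have hr0 : r ≠ 0 := (Real.sqrt_pos.mpr hpos).ne'
  have hr2 : r ^ 2 = ∑ i, q i ^ 2 := Real.sq_sqrt hpos.le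
  have unit : ∑ i, (r⁻¹ • q) i ^ 2 = 1 := by
    simp only [Pi.smul_apply, smul_eq_mul, mul_pow, ← Finset.mul_sum, ← hr2]
    field_simp
  have fixed : (r⁻¹ • q) ᵥ* C = r⁻¹ • q := by rw [smul_vecMul, hfix]
  have key := sum_sq_sub_vecMulVec_self C _ unit fixed
  refine ⟨?_, fun h => ⟨r⁻¹ • q, unit, ?_, r, (smul_inv_smul₀ hr0 q).symm⟩, ?_⟩
  · have : 0 ≤ ∑ i, ∑ j, (C i j - (r⁻¹ • q) i * (r⁻¹ • q) j) ^ 2 := by positivity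
    exact Real.one_le_sqrt.mpr (by linarith)
  · rw [Real.sqrt_eq_one.mp h, sub_self] at key
    ext i j
    rw [Finset.sum_eq_zero_iff_of_nonneg fun i _ => Finset.sum_nonneg fun j _ => sq_nonneg _] at key
    have hij := (Finset.sum_eq_zero_iff_of_nonneg fun j _ => sq_nonneg _).mp
      (key i (Finset.mem_univ i)) j (Finset.mem_univ j)
    exact sub_eq_zero.mp (sq_eq_zero_iff.mp hij)
  · rintro ⟨v, hv, rfl, -⟩
    simp_rw [frobNorm, vecMulVec_apply, mul_pow, ← Finset.mul_sum, hv, mul_one, hv, Real.sqrt_one]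
end

section
/- Let d, N be positive integers and τ > 0. Consider the problem of minimizing ‖C‖_F over all pairs (Z, C) with Z ∈ ℝ^{d×N}, C ∈ ℝ^{N×N}, subject to Z = ZC and ‖Z‖_F² ≥ τ. The optimal value is 1, and a feasible pair (Z, C) is optimal if and only if there exist a unit vector q ∈ ℝ^N and a vector z ∈ ℝ^d with ‖z‖² ≥ τ such that Z = z qᵀ and C = q qᵀ. -/
open Matrix

lemma frobSq_vecMulVec {m n : ℕ} (z : Fin m → ℝ) (q : Fin n → ℝ) :
    frobSq (vecMulVec z q) = (∑ k, z k ^ 2) * ∑ i, q i ^ 2 := by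
  simp only [frobSq, vecMulVec_apply, mul_pow, Finset.sum_mul_sum]

lemma frobNorm_eq_sqrt_frobSq {m n : ℕ} (A : Matrix (Fin m) (Fin n) ℝ) :
    frobNorm A = √(frobSq A) := rfl

lemma frobSq_nonneg {m n : ℕ} (A : Matrix (Fin m) (Fin n) ℝ) : 0 ≤ frobSq A := by
  unfold frobSq
  positivity

lemma frobSq_eq_zero_iff {m n : ℕ} {A : Matrix (Fin m) (Fin n) ℝ} :
    frobSq A = 0 ↔ A = 0 := by
  constructor
  · intro h
    ext i j
    have hi := (Finset.sum_eq_zero_iff_of_nonneg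
      (fun i _ => Finset.sum_nonneg fun j _ => sq_nonneg (A i j))).1 h i (Finset.mem_univ i)
    have hij := (Finset.sum_eq_zero_iff_of_nonneg (fun j _ => sq_nonneg (A i j))).1 hi j
      (Finset.mem_univ j)
    simpa using hij
  · rintro rfl
    simp [frobSq]

/-- A unit left fixed vector `q` of `C` splits `C` orthogonally as `q qᵀ + (C - q qᵀ)`. -/
lemma frobSq_eq_one_add_of_vecMul_eq {n : ℕ} {C : Matrix (Fin n) (Fin n) ℝ} {q : Fin n → ℝ}
    (hq : ∑ i, q i ^ 2 = 1) (hC : q ᵥ* C = q) :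
    frobSq C = 1 + frobSq (C - vecMulVec q q) := by
  have hinner : ∑ i, ∑ j, C i j * (q i * q j) = 1 := by
    rw [Finset.sum_comm, ← hq]
    refine Finset.sum_congr rfl fun j _ => ?_
    have hj : ∑ i, q i * C i j = q j := congrFun hC j
    rw [sq]
    nth_rewrite 2 [← hj]
    rw [Finset.sum_mul]
    exact Finset.sum_congr rfl fun i _ => by ring
  have hqq : frobSq (vecMulVec q q) = 1 := by rw [frobSq_vecMulVec, hq, one_mul]
  have hexpand : frobSq (C - vecMulVec q q) =
      frobSq C - 2 * (∑ i, ∑ j, C i j * (q i * q j)) + frobSq (vecMulVec q q) := by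
    simp only [frobSq, Matrix.sub_apply, vecMulVec_apply, Finset.mul_sum, ← Finset.sum_sub_distrib,
      ← Finset.sum_add_distrib]
    exact Finset.sum_congr rfl fun i _ => Finset.sum_congr rfl fun j _ => by ring
  rw [hexpand, hinner, hqq]
  ring

lemma exists_unit_vecMul_eq {m n : ℕ} {Z : Matrix (Fin m) (Fin n) ℝ}
    {C : Matrix (Fin n) (Fin n) ℝ} (hZC : Z = Z * C) (hZ : 0 < frobSq Z) :
    ∃ q : Fin n → ℝ, ∑ i, q i ^ 2 = 1 ∧ q ᵥ* C = q := by
  obtain ⟨k, -, hk⟩ := Finset.exists_lt_of_sum_lt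
    (show ∑ _k : Fin m, (0 : ℝ) < ∑ k, ∑ j, Z k j ^ 2 by simpa [frobSq] using hZ)
  have hfix : Z k ᵥ* C = Z k := by
    rw [← mul_apply_eq_vecMul, ← hZC]
  refine ⟨(√(∑ j, Z k j ^ 2))⁻¹ • Z k, ?_, by rw [smul_vecMul, hfix]⟩
  simp only [Pi.smul_apply, smul_eq_mul, mul_pow, ← Finset.mul_sum, inv_pow,
    Real.sq_sqrt hk.le]
  exact inv_mul_cancel₀ hk.ne'

theorem stmt12 (d N : ℕ) (hd : 0 < d) (hN : 0 < N) (τ : ℝ) (hτ : 0 < τ) :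
    IsLeast {y : ℝ | ∃ (Z : Matrix (Fin d) (Fin N) ℝ) (C : Matrix (Fin N) (Fin N) ℝ),
        Z = Z * C ∧ τ ≤ frobSq Z ∧ y = frobNorm C} 1 ∧
    ∀ (Z : Matrix (Fin d) (Fin N) ℝ) (C : Matrix (Fin N) (Fin N) ℝ),
      Z = Z * C → τ ≤ frobSq Z →
      (frobNorm C = 1 ↔
        ∃ (q : Fin N → ℝ) (z : Fin d → ℝ),
          (∑ i, q i ^ 2) = 1 ∧ τ ≤ ∑ k, z k ^ 2 ∧
          Z = Matrix.vecMulVec z q ∧ C = Matrix.vecMulVec q q) := by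
  have hval : ∀ q : Fin N → ℝ, ∑ i, q i ^ 2 = 1 → frobNorm (vecMulVec q q) = 1 := by
    intro q hq
    rw [frobNorm_eq_sqrt_frobSq, frobSq_vecMulVec, hq, one_mul, Real.sqrt_one]
  refine ⟨⟨?_, ?_⟩, fun Z C hZC hZ => ⟨fun hC => ?_, ?_⟩⟩
  · let q : Fin N → ℝ := Pi.single ⟨0, hN⟩ 1
    let z : Fin d → ℝ := Pi.single ⟨0, hd⟩ √τ
    have hq : ∑ i, q i ^ 2 = 1 := by simp [q, Pi.single_apply]
    have hz : ∑ k, z k ^ 2 = τ := by simp [z, Pi.single_apply, Real.sq_sqrt hτ.le]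
    have hqq : q ⬝ᵥ q = 1 := by simpa only [dotProduct, sq] using hq
    refine ⟨vecMulVec z q, vecMulVec q q, ?_, ?_, (hval q hq).symm⟩
    · rw [vecMulVec_mul_vecMulVec, hqq, one_smul]
    · rw [frobSq_vecMulVec, hz, hq, mul_one]
  · rintro _ ⟨Z, C, hZC, hZ, rfl⟩
    obtain ⟨q, hq, hqC⟩ := exists_unit_vecMul_eq hZC (hτ.trans_le hZ)
    rw [frobNorm_eq_sqrt_frobSq, Real.one_le_sqrt, frobSq_eq_one_add_of_vecMul_eq hq hqC]
    exact le_add_of_nonneg_right (frobSq_nonneg _)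
  · obtain ⟨q, hq, hqC⟩ := exists_unit_vecMul_eq hZC (hτ.trans_le hZ)
    rw [frobNorm_eq_sqrt_frobSq, Real.sqrt_eq_one, frobSq_eq_one_add_of_vecMul_eq hq hqC,
      add_eq_left, frobSq_eq_zero_iff, sub_eq_zero] at hC
    have hZq : Z = vecMulVec (Z *ᵥ q) q := by rw [← mul_vecMulVec, ← hC, ← hZC]
    refine ⟨q, Z *ᵥ q, hq, ?_, hZq, hC⟩
    rwa [hZq, frobSq_vecMulVec, hq, mul_one] at hZ
  · rintro ⟨q, z, hq, -, -, rfl⟩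
    exact hval q hq
end

section
/- Let τ > 0, let Z ∈ ℝ^{d×N} have every column Z_i of Euclidean norm ‖Z_i‖ = τ, and let z ∈ ℝ^d with ‖z‖ = τ. Suppose there exists at least one index i with Z_i = z or Z_i = −z. Then the minimum of ‖c‖₁ over all c ∈ ℝ^N satisfying z = Zc equals 1, and every minimizer c* satisfies: c*_i ≠ 0 implies Z_i = sgn(c*_i)·z. -/
open Matrix

/-- The excess of `∑ i, |c i|` over `1` is a weighted sum of squared distances from the columns
to the signed copies of the represented vector. -/
theorem sum_abs_mul_sum_sub_sign_sq {m n : Type*} [Fintype m] [Fintype n] (t : ℝ)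
    (Z : Matrix m n ℝ) (z : m → ℝ) (hcols : ∀ i, ∑ k, Z k i ^ 2 = t)
    (hz : ∑ k, z k ^ 2 = t) (c : n → ℝ) (hc : Z.mulVec c = z) :
    ∑ i, |c i| * ∑ k, (Z k i - Real.sign (c i) * z k) ^ 2 = 2 * t * (∑ i, |c i| - 1) := by
  have hinner : ∑ i, c i * ∑ k, Z k i * z k = t := by
    simp only [Finset.mul_sum]
    rw [Finset.sum_comm, ← hz]
    refine Finset.sum_congr rfl fun k _ => ?_
    have hk : ∑ i, Z k i * c i = z k := congrFun hc k
    rw [sq]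
    nth_rewrite 2 [← hk]
    rw [Finset.sum_mul]
    exact Finset.sum_congr rfl fun i _ => by ring
  have hterm (i : n) : |c i| * ∑ k, (Z k i - Real.sign (c i) * z k) ^ 2
      = 2 * t * |c i| - 2 * (c i * ∑ k, Z k i * z k) := by
    have hexpand : ∑ k, (Z k i - Real.sign (c i) * z k) ^ 2
        = t - 2 * Real.sign (c i) * ∑ k, Z k i * z k + Real.sign (c i) ^ 2 * t := by
      nth_rewrite 2 [← hz]
      rw [← hcols i, Finset.mul_sum, Finset.mul_sum, ← Finset.sum_sub_distrib,
        ← Finset.sum_add_distrib]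
      exact Finset.sum_congr rfl fun k _ => by ring
    rw [hexpand]
    rcases lt_trichotomy (c i) 0 with h | h | h
    · rw [Real.sign_of_neg h, abs_of_neg h]; ring
    · simp [h]
    · rw [Real.sign_of_pos h, abs_of_pos h]; ring
  rw [Finset.sum_congr rfl fun i _ => hterm i, Finset.sum_sub_distrib, ← Finset.mul_sum,
    ← Finset.mul_sum, hinner]
  ring

theorem stmt14 (d N : ℕ) (τ : ℝ) (hτ : 0 < τ)
    (Z : Matrix (Fin d) (Fin N) ℝ) (z : Fin d → ℝ)
    (hcols : ∀ i, Real.sqrt (∑ k, Z k i ^ 2) = τ)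
    (hz : Real.sqrt (∑ k, z k ^ 2) = τ)
    (hex : ∃ i, (∀ k, Z k i = z k) ∨ (∀ k, Z k i = - z k)) :
    IsLeast {y : ℝ | ∃ c : Fin N → ℝ, Z.mulVec c = z ∧ y = ∑ i, |c i|} 1 ∧
    ∀ c : Fin N → ℝ, Z.mulVec c = z → (∑ i, |c i|) = 1 →
      ∀ i, c i ≠ 0 → ∀ k, Z k i = Real.sign (c i) * z k := by
  have sq_of_sqrt (v : Fin d → ℝ) (hv : Real.sqrt (∑ k, v k ^ 2) = τ) :
      ∑ k, v k ^ 2 = τ ^ 2 := by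
    rw [← hv, Real.sq_sqrt (Finset.sum_nonneg fun k _ => sq_nonneg _)]
  have key := sum_abs_mul_sum_sub_sign_sq (τ ^ 2) Z z
    (fun i => sq_of_sqrt (fun k => Z k i) (hcols i)) (sq_of_sqrt z hz)
  have inner_nonneg (c : Fin N → ℝ) (i : Fin N) :
      0 ≤ ∑ k, (Z k i - Real.sign (c i) * z k) ^ 2 :=
    Finset.sum_nonneg fun k _ => sq_nonneg _
  have term_nonneg (c : Fin N → ℝ) (i : Fin N) :
      0 ≤ |c i| * ∑ k, (Z k i - Real.sign (c i) * z k) ^ 2 :=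
    mul_nonneg (abs_nonneg _) (inner_nonneg c i)
  refine ⟨⟨?_, ?_⟩, ?_⟩
  · obtain ⟨i, h | h⟩ := hex
    · refine ⟨Pi.single i 1, ?_, ?_⟩
      · ext k
        simp [h]
      · simp [Pi.single_apply, apply_ite abs]
    · refine ⟨Pi.single i (-1), ?_, ?_⟩
      · ext k
        simp [Matrix.mulVec, dotProduct, Pi.single_apply, h]
      · simp [Pi.single_apply, apply_ite abs]
  · rintro y ⟨c, hc, rfl⟩
    have hnonneg : 0 ≤ 2 * τ ^ 2 * (∑ i, |c i| - 1) :=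
      key c hc ▸ Finset.sum_nonneg fun i _ => term_nonneg c i
    exact sub_nonneg.mp (nonneg_of_mul_nonneg_right hnonneg (by positivity))
  · intro c hc hsum i hi k
    have hzero := key c hc
    rw [hsum, sub_self, mul_zero,
      Finset.sum_eq_zero_iff_of_nonneg fun i _ => term_nonneg c i] at hzero
    have hcol := (mul_eq_zero.mp (hzero i (Finset.mem_univ i))).resolve_left (abs_ne_zero.mpr hi)
    rw [Finset.sum_eq_zero_iff_of_nonneg fun k _ => sq_nonneg _] at hcol
    exact sub_eq_zero.mp (pow_eq_zero_iff two_ne_zero |>.mp (hcol k (Finset.mem_univ k)))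
end

section
/- Let τ > 0, let Z ∈ ℝ^{d×N} have every column Z_i of Euclidean norm ‖Z_i‖ = τ, and let z ∈ ℝ^d with ‖z‖ = τ. Suppose that no column of Z equals z or −z. Then every c ∈ ℝ^N satisfying z = Zc has ‖c‖₁ > 1. -/
open Matrix

/-- Strict Cauchy–Schwarz for two vectors of equal norm that do not agree up to sign. -/
lemma abs_dotProduct_lt_of_ne_of_ne_neg {ι : Type*} [Fintype ι] {u v : ι → ℝ} {s : ℝ}
    (hu : u ⬝ᵥ u = s) (hv : v ⬝ᵥ v = s) (hne : u ≠ v) (hne_neg : u ≠ -v) :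
    |u ⬝ᵥ v| < s := by
  have hsub : 0 < (u - v) ⬝ᵥ (u - v) :=
    (Finset.sum_nonneg fun i _ => mul_self_nonneg ((u - v) i)).lt_of_ne'
      fun h => hne (sub_eq_zero.mp (dotProduct_self_eq_zero.mp h))
  have hadd : 0 < (u + v) ⬝ᵥ (u + v) :=
    (Finset.sum_nonneg fun i _ => mul_self_nonneg ((u + v) i)).lt_of_ne'
      fun h => hne_neg (eq_neg_of_add_eq_zero_left (dotProduct_self_eq_zero.mp h))
  simp only [sub_dotProduct, dotProduct_sub, add_dotProduct, dotProduct_add,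
    dotProduct_comm v u] at hsub hadd
  rw [abs_lt]
  constructor <;> linarith

lemma dotProduct_self_eq_sq_of_sqrt_sum_sq_eq {ι : Type*} [Fintype ι] {u : ι → ℝ} {τ : ℝ}
    (h : Real.sqrt (∑ k, u k ^ 2) = τ) : u ⬝ᵥ u = τ ^ 2 := by
  rw [← h, Real.sq_sqrt (Finset.sum_nonneg fun k _ => sq_nonneg (u k))]
  simp only [dotProduct, sq]

theorem stmt15 (d N : ℕ) (τ : ℝ) (hτ : 0 < τ)
    (Z : Matrix (Fin d) (Fin N) ℝ) (z : Fin d → ℝ)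
    (hcols : ∀ i, Real.sqrt (∑ k, Z k i ^ 2) = τ)
    (hz : Real.sqrt (∑ k, z k ^ 2) = τ)
    (hno : ∀ i, ¬((∀ k, Z k i = z k) ∨ (∀ k, Z k i = - z k))) :
    ∀ c : Fin N → ℝ, Z.mulVec c = z → 1 < ∑ i, |c i| := by
  intro c hc
  have hzz : z ⬝ᵥ z = τ ^ 2 := dotProduct_self_eq_sq_of_sqrt_sum_sq_eq hz
  have hτ2 : 0 < τ ^ 2 := pow_pos hτ 2
  have hlt (i : Fin N) : |Z.col i ⬝ᵥ z| < τ ^ 2 :=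
    abs_dotProduct_lt_of_ne_of_ne_neg (dotProduct_self_eq_sq_of_sqrt_sum_sq_eq (hcols i)) hzz
      (fun h => hno i (Or.inl (congrFun h))) (fun h => hno i (Or.inr (congrFun h)))
  have hexp : τ ^ 2 = ∑ i, (Z.col i ⬝ᵥ z) * c i := by
    calc τ ^ 2 = z ⬝ᵥ Z *ᵥ c := by rw [hc, hzz]
      _ = (z ᵥ* Z) ⬝ᵥ c := dotProduct_mulVec z Z c
      _ = ∑ i, (Z.col i ⬝ᵥ z) * c i :=
        Finset.sum_congr rfl fun i _ => congrArg (· * c i) (dotProduct_comm z (Z.col i))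
  obtain ⟨j, hj⟩ : ∃ j, c j ≠ 0 := by
    by_contra! h
    simp [h, hτ.ne'] at hexp
  have hsum : τ ^ 2 < τ ^ 2 * ∑ i, |c i| := by
    calc τ ^ 2 = ∑ i, (Z.col i ⬝ᵥ z) * c i := hexp
      _ ≤ ∑ i, |Z.col i ⬝ᵥ z| * |c i| :=
        Finset.sum_le_sum fun i _ => (le_abs_self _).trans (abs_mul _ _).le
      _ < ∑ i, τ ^ 2 * |c i| :=
        Finset.sum_lt_sum (fun i _ => mul_le_mul_of_nonneg_right (hlt i).le (abs_nonneg _))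
          ⟨j, Finset.mem_univ j, mul_lt_mul_of_pos_right (hlt j) (abs_pos.mpr hj)⟩
      _ = τ ^ 2 * ∑ i, |c i| := (Finset.mul_sum _ _ _).symm
  exact (lt_mul_iff_one_lt_right hτ2).mp hsum
end

section
/- Let τ > 0 and let Z ∈ ℝ^{d×N} have every column Z_i of Euclidean norm ‖Z_i‖² = τ. Suppose there exists an index i₀ such that Z_{i₀} ≠ Z_j and Z_{i₀} ≠ −Z_j for every j ≠ i₀. Then every C ∈ ℝ^{N×N} with zero diagonal satisfying Z = ZC has ‖C‖₁ > N. -/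
open Matrix

section EqualNorms

variable {κ ι : Type*} [Fintype κ] {τ : ℝ}

theorem dotProduct_le_of_sum_sq_eq {u v : κ → ℝ} (hu : ∑ k, u k ^ 2 = τ)
    (hv : ∑ k, v k ^ 2 = τ) : u ⬝ᵥ v ≤ τ := by
  have h : ∑ k, u k * v k ≤ ∑ k, (u k ^ 2 + v k ^ 2) / 2 :=
    Finset.sum_le_sum fun k _ => by nlinarith [sq_nonneg (u k - v k)]
  rw [← Finset.sum_div, Finset.sum_add_distrib, hu, hv] at h
  simpa [dotProduct] using h

theorem dotProduct_lt_of_sum_sq_eq {u v : κ → ℝ} (hu : ∑ k, u k ^ 2 = τ)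
    (hv : ∑ k, v k ^ 2 = τ) (hne : u ≠ v) : u ⬝ᵥ v < τ := by
  obtain ⟨k₀, hk₀⟩ := Function.ne_iff.mp hne
  have h : ∑ k, u k * v k < ∑ k, (u k ^ 2 + v k ^ 2) / 2 :=
    Finset.sum_lt_sum (fun k _ => by nlinarith [sq_nonneg (u k - v k)])
      ⟨k₀, Finset.mem_univ _, by nlinarith [sq_pos_of_ne_zero (sub_ne_zero.mpr hk₀)]⟩
  rw [← Finset.sum_div, Finset.sum_add_distrib, hu, hv] at h
  simpa [dotProduct] using h

theorem abs_dotProduct_le_of_sum_sq_eq {u v : κ → ℝ} (hu : ∑ k, u k ^ 2 = τ)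
    (hv : ∑ k, v k ^ 2 = τ) : |u ⬝ᵥ v| ≤ τ := by
  refine abs_le'.mpr ⟨dotProduct_le_of_sum_sq_eq hu hv, ?_⟩
  rw [← dotProduct_neg]
  exact dotProduct_le_of_sum_sq_eq hu (by simpa using hv)

theorem abs_dotProduct_lt_of_sum_sq_eq {u v : κ → ℝ} (hu : ∑ k, u k ^ 2 = τ)
    (hv : ∑ k, v k ^ 2 = τ) (hne : u ≠ v) (hne_neg : u ≠ -v) : |u ⬝ᵥ v| < τ := by
  refine max_lt (dotProduct_lt_of_sum_sq_eq hu hv hne) ?_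
  rw [← dotProduct_neg]
  exact dotProduct_lt_of_sum_sq_eq hu (by simpa using hv) hne_neg

variable [Fintype ι]

theorem eq_sum_mul_dotProduct_of_eq_mul {Z : Matrix κ ι ℝ} {C : Matrix ι ι ℝ} {i : ι}
    (hi : ∑ k, Z k i ^ 2 = τ) (hZC : Z = Z * C) :
    τ = ∑ j, C j i * (Z.col i ⬝ᵥ Z.col j) := by
  have h : ∀ k, Z k i = ∑ j, Z k j * C j i := fun k => congrFun (congrFun hZC k) i
  calc τ = ∑ k, Z k i * ∑ j, Z k j * C j i := by
        rw [← hi]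
        exact Finset.sum_congr rfl fun k _ => by rw [← h k, sq]
    _ = ∑ j, C j i * (Z.col i ⬝ᵥ Z.col j) := by
        simp only [dotProduct, Matrix.col_apply, Finset.mul_sum]
        rw [Finset.sum_comm]
        exact Finset.sum_congr rfl fun j _ => Finset.sum_congr rfl fun k _ => by ring

theorem one_le_sum_abs_of_eq_mul (hτ : 0 < τ) {Z : Matrix κ ι ℝ}
    (hcols : ∀ i, ∑ k, Z k i ^ 2 = τ) {C : Matrix ι ι ℝ} (hZC : Z = Z * C) (i : ι) :
    1 ≤ ∑ j, |C j i| := by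
  refine le_of_mul_le_mul_right ?_ hτ
  calc 1 * τ = ∑ j, C j i * (Z.col i ⬝ᵥ Z.col j) := by
        rw [one_mul]
        exact eq_sum_mul_dotProduct_of_eq_mul (hcols i) hZC
    _ ≤ ∑ j, |C j i| * τ := Finset.sum_le_sum fun j _ => by
        refine (le_abs_self _).trans ?_
        rw [abs_mul]
        gcongr
        exact abs_dotProduct_le_of_sum_sq_eq (hcols i) (hcols j)
    _ = (∑ j, |C j i|) * τ := (Finset.sum_mul ..).symm

theorem one_lt_sum_abs_of_eq_mul (hτ : 0 < τ) {Z : Matrix κ ι ℝ}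
    (hcols : ∀ i, ∑ k, Z k i ^ 2 = τ) {C : Matrix ι ι ℝ} (hZC : Z = Z * C) {i : ι}
    (hdiag : C i i = 0) (hdist : ∀ j ≠ i, Z.col i ≠ Z.col j ∧ Z.col i ≠ -Z.col j) :
    1 < ∑ j, |C j i| := by
  have heq := eq_sum_mul_dotProduct_of_eq_mul (hcols i) hZC
  obtain ⟨j₀, hj₀⟩ : ∃ j, C j i ≠ 0 := by
    by_contra! h
    simp only [h, zero_mul, Finset.sum_const_zero] at heq
    exact hτ.ne' heq
  have hj₀i : j₀ ≠ i := by
    rintro rfl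
    exact hj₀ hdiag
  refine lt_of_mul_lt_mul_right ?_ hτ.le
  calc 1 * τ = ∑ j, C j i * (Z.col i ⬝ᵥ Z.col j) := by rw [one_mul, ← heq]
    _ ≤ ∑ j, |C j i| * |Z.col i ⬝ᵥ Z.col j| := Finset.sum_le_sum fun j _ =>
        (le_abs_self _).trans (abs_mul _ _).le
    _ < ∑ j, |C j i| * τ := Finset.sum_lt_sum
        (fun j _ => mul_le_mul_of_nonneg_left
          (abs_dotProduct_le_of_sum_sq_eq (hcols i) (hcols j)) (abs_nonneg _))
        ⟨j₀, Finset.mem_univ _, mul_lt_mul_of_pos_left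
          (abs_dotProduct_lt_of_sum_sq_eq (hcols i) (hcols j₀) (hdist j₀ hj₀i).1
            (hdist j₀ hj₀i).2) (abs_pos.mpr hj₀)⟩
    _ = (∑ j, |C j i|) * τ := (Finset.sum_mul ..).symm

end EqualNorms

theorem stmt17 (d N : ℕ) (τ : ℝ) (hτ : 0 < τ)
    (Z : Matrix (Fin d) (Fin N) ℝ) (hcols : ∀ i, (∑ k, Z k i ^ 2) = τ)
    (i0 : Fin N)
    (hdist : ∀ j, j ≠ i0 → ¬((∀ k, Z k i0 = Z k j) ∨ (∀ k, Z k i0 = - Z k j))) :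
    ∀ C : Matrix (Fin N) (Fin N) ℝ, (∀ i, C i i = 0) → Z = Z * C → (N : ℝ) < l1 C := by
  intro C hdiag hZC
  have hcol : ∀ j ≠ i0, Z.col i0 ≠ Z.col j ∧ Z.col i0 ≠ -Z.col j := fun j hj =>
    ⟨fun h => hdist j hj (Or.inl (congrFun h)), fun h => hdist j hj (Or.inr (congrFun h))⟩
  calc (N : ℝ) = ∑ _i : Fin N, (1 : ℝ) := by simp
    _ < ∑ i, ∑ j, |C j i| := Finset.sum_lt_sum
        (fun i _ => one_le_sum_abs_of_eq_mul hτ hcols hZC i)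
        ⟨i0, Finset.mem_univ _, one_lt_sum_abs_of_eq_mul hτ hcols hZC (hdiag i0) hcol⟩
    _ = l1 C := Finset.sum_comm
end

section
/- Let τ > 0 and let Z ∈ ℝ^{d×N} (N ≥ 2) have every column Z_i of Euclidean norm ‖Z_i‖² = τ. Suppose that for every index i there exists an index j ≠ i with Z_i = Z_j or Z_i = −Z_j. Then the minimum of ‖C‖₁ over all C ∈ ℝ^{N×N} with zero diagonal satisfying Z = ZC equals N; in particular such a C exists and attains ‖C‖₁ = N, and every feasible C satisfies ‖C‖₁ ≥ N. -/
open Matrix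

/-- Vectors of equal squared Euclidean length `τ` have inner product at most `τ` in absolute
value. -/
lemma abs_sum_mul_le_of_sum_sq_eq {ι : Type*} [Fintype ι] {τ : ℝ} {u v : ι → ℝ}
    (hu : ∑ k, u k ^ 2 = τ) (hv : ∑ k, v k ^ 2 = τ) : |∑ k, u k * v k| ≤ τ := by
  have hτ : 0 ≤ τ := hu ▸ Finset.sum_nonneg fun k _ => sq_nonneg (u k)
  refine abs_le_of_sq_le_sq ?_ hτ
  have h := Finset.sum_mul_sq_le_sq_mul_sq Finset.univ u v
  rwa [hu, hv, ← sq] at h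

/-- If all columns of `Z` have the same positive length, each column of a matrix `C` with
`Z = Z * C` has ℓ1 norm at least `1`. -/
lemma one_le_sum_abs_col {m n : Type*} [Fintype m] [Fintype n] {τ : ℝ} (hτ : 0 < τ)
    {Z : Matrix m n ℝ} (hcols : ∀ i, ∑ k, Z k i ^ 2 = τ) {C : Matrix n n ℝ} (hC : Z = Z * C)
    (i : n) : 1 ≤ ∑ j, |C j i| := by
  have hentry (k : m) : Z k i = ∑ j, Z k j * C j i := by
    rw [← Matrix.mul_apply, ← hC]
  have hτ_eq : τ = ∑ j, (∑ k, Z k i * Z k j) * C j i := by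
    calc τ = ∑ k, Z k i * ∑ j, Z k j * C j i := by
          rw [← hcols i]
          exact Finset.sum_congr rfl fun k _ => by rw [← hentry, sq]
      _ = ∑ j, (∑ k, Z k i * Z k j) * C j i := by
          simp_rw [Finset.mul_sum, Finset.sum_mul, mul_assoc]
          exact Finset.sum_comm
  have hle : τ * 1 ≤ τ * ∑ j, |C j i| := by
    calc τ * 1 = ∑ j, (∑ k, Z k i * Z k j) * C j i := by rw [mul_one, ← hτ_eq]
      _ ≤ ∑ j, τ * |C j i| := by
          refine Finset.sum_le_sum fun j _ => (le_abs_self _).trans ?_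
          rw [abs_mul]
          exact mul_le_mul_of_nonneg_right
            (abs_sum_mul_le_of_sum_sq_eq (hcols i) (hcols j)) (abs_nonneg _)
      _ = τ * ∑ j, |C j i| := (Finset.mul_sum _ _ _).symm
  exact le_of_mul_le_mul_left hle hτ

/-- If every column of `Z` is a signed copy of another column, then `Z = Z * C` for some `C` with
zero diagonal and ℓ1 norm equal to the number of columns. -/
lemma exists_zero_diag_eq_mul_l1_eq {d N : ℕ} {Z : Matrix (Fin d) (Fin N) ℝ}
    (hdup : ∀ i, ∃ j, j ≠ i ∧ ((∀ k, Z k i = Z k j) ∨ (∀ k, Z k i = - Z k j))) :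
    ∃ C : Matrix (Fin N) (Fin N) ℝ, (∀ i, C i i = 0) ∧ Z = Z * C ∧ (N : ℝ) = l1 C := by
  have hsign (i : Fin N) : ∃ j, ∃ s : ℝ, j ≠ i ∧ |s| = 1 ∧ ∀ k, Z k i = Z k j * s := by
    obtain ⟨j, hj, h | h⟩ := hdup i
    · exact ⟨j, 1, hj, by simp, by simpa using h⟩
    · exact ⟨j, -1, hj, by simp, by simpa using h⟩
  choose f s hf hs hZ using hsign
  refine ⟨Matrix.of fun a i => if a = f i then s i else 0, fun i => ?_, ?_, ?_⟩
  · simp [(hf i).symm]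
  · ext k i
    simp [Matrix.mul_apply, ← hZ]
  · rw [l1, Finset.sum_comm]
    simp [apply_ite abs, hs]

theorem stmt18 (d N : ℕ) (hN : 2 ≤ N) (τ : ℝ) (hτ : 0 < τ)
    (Z : Matrix (Fin d) (Fin N) ℝ) (hcols : ∀ i, (∑ k, Z k i ^ 2) = τ)
    (hdup : ∀ i, ∃ j, j ≠ i ∧ ((∀ k, Z k i = Z k j) ∨ (∀ k, Z k i = - Z k j))) :
    IsLeast {y : ℝ | ∃ C : Matrix (Fin N) (Fin N) ℝ,
        (∀ i, C i i = 0) ∧ Z = Z * C ∧ y = l1 C} (N : ℝ) ∧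
    ∀ C : Matrix (Fin N) (Fin N) ℝ, (∀ i, C i i = 0) → Z = Z * C → (N : ℝ) ≤ l1 C := by
  have hlower (C : Matrix (Fin N) (Fin N) ℝ) (hC : Z = Z * C) : (N : ℝ) ≤ l1 C := by
    rw [l1, Finset.sum_comm]
    simpa using Finset.sum_le_sum fun i (_ : i ∈ Finset.univ) => one_le_sum_abs_col hτ hcols hC i
  refine ⟨⟨exists_zero_diag_eq_mul_l1_eq hdup, ?_⟩, fun C _ hC => hlower C hC⟩
  rintro y ⟨C, -, hC, rfl⟩
  exact hlower C hC
end

section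
/- Let relu denote the map x ↦ max(x,0) applied entrywise. For X ∈ ℝ^{d×N}, τ > 0, and ε > 0, there exist matrices W_e¹, W_e², W_d¹, W_d² ∈ ℝ^{d×d} and vectors b_e¹, b_e², b_d¹, b_d² ∈ ℝ^d such that, defining the encoder E(x) = W_e²·relu(W_e¹ x + b_e¹) + b_e² and the decoder D(z) = W_d²·relu(W_d¹ z + b_d¹) + b_d² on ℝ^d, the following hold for the columns X_1, …, X_N of X: (1) ‖E(X_i) − E(X_j)‖ ≤ ε for all i, j; (2) |‖E(X_i)‖ − τ| ≤ ε for all i; and (3) D(E(X_i)) = X_i for all i. -/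
open Matrix

/-- Entrywise ReLU applied to a vector. -/
noncomputable def reluVec {d : ℕ} (x : Fin d → ℝ) : Fin d → ℝ :=
  fun k => max (x k) 0

/-- Euclidean norm of a vector in `ℝ^d`. -/
noncomputable def vnorm {d : ℕ} (x : Fin d → ℝ) : ℝ :=
  Real.sqrt (∑ k, x k ^ 2)

theorem vnorm_eq_norm_toLp {d : ℕ} (x : Fin d → ℝ) : vnorm x = ‖WithLp.toLp 2 x‖ := by
  simp [vnorm, EuclideanSpace.norm_eq]

theorem reluVec_of_nonneg {d : ℕ} {x : Fin d → ℝ} (hx : ∀ k, 0 ≤ x k) : reluVec x = x :=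
  funext fun k => max_eq_left (hx k)

theorem stmt19 (d N : ℕ) (hd : 0 < d) (X : Matrix (Fin d) (Fin N) ℝ)
    (τ ε : ℝ) (hτ : 0 < τ) (hε : 0 < ε) :
    ∃ (We1 We2 Wd1 Wd2 : Matrix (Fin d) (Fin d) ℝ) (be1 be2 bd1 bd2 : Fin d → ℝ),
      let E : (Fin d → ℝ) → (Fin d → ℝ) :=
        fun x => We2.mulVec (reluVec (We1.mulVec x + be1)) + be2
      let D : (Fin d → ℝ) → (Fin d → ℝ) :=
        fun z => Wd2.mulVec (reluVec (Wd1.mulVec z + bd1)) + bd2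
      (∀ i j : Fin N, vnorm (E (fun k => X k i) - E (fun k => X k j)) ≤ ε) ∧
      (∀ i : Fin N, |vnorm (E (fun k => X k i)) - τ| ≤ ε) ∧
      (∀ i : Fin N, D (E (fun k => X k i)) = fun k => X k i) := by
  obtain ⟨M, hM⟩ : ∃ M : ℝ, ∀ i k, 0 ≤ X k i + M := by
    obtain ⟨M, hM⟩ := (Set.finite_range fun q : Fin N × Fin d => -X q.2 q.1).bddAbove
    exact ⟨M, fun i k => by linarith [hM ⟨(i, k), rfl⟩]⟩
  let m : Fin d → ℝ := fun _ => M
  let y : Fin N → Fin d → ℝ := fun i => (fun k => X k i) + m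
  obtain ⟨C, hC0, hC⟩ : ∃ C : ℝ, 0 < C ∧ ∀ i, ‖WithLp.toLp 2 (y i)‖ ≤ C := by
    obtain ⟨C, hC⟩ := (Set.finite_range fun i => ‖WithLp.toLp 2 (y i)‖).bddAbove
    exact ⟨max C 1, by positivity, fun i => (hC ⟨i, rfl⟩).trans (le_max_left _ _)⟩
  let δ : ℝ := ε / (2 * C)
  have hδ : 0 < δ := by positivity
  have hδC : δ * (2 * C) = ε := div_mul_cancel₀ _ (by positivity)
  let p : Fin d → ℝ := Pi.single ⟨0, hd⟩ τ
  have hp : ‖WithLp.toLp 2 p‖ = τ := by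
    simp [p, abs_of_pos hτ]
  have hy : ∀ i, reluVec (y i) = y i := fun i => reluVec_of_nonneg (hM i)
  refine ⟨1, δ • 1, δ⁻¹ • 1, 1, m, p, -(δ⁻¹ • p), -m, ?_⟩
  intro E D
  have hE : ∀ i, E (fun k => X k i) = δ • y i + p := fun i => by
    simp only [E, one_mulVec, smul_mulVec]
    rw [hy i]
  refine ⟨fun i j => ?_, fun i => ?_, fun i => ?_⟩
  · rw [hE, hE, add_sub_add_right_eq_sub, ← smul_sub, vnorm_eq_norm_toLp, WithLp.toLp_smul,
      norm_smul, Real.norm_of_nonneg hδ.le, WithLp.toLp_sub, ← hδC]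
    gcongr
    linarith [norm_sub_le (WithLp.toLp 2 (y i)) (WithLp.toLp 2 (y j)), hC i, hC j]
  · rw [hE, vnorm_eq_norm_toLp, ← hp]
    refine (abs_norm_sub_norm_le _ _).trans ?_
    rw [← WithLp.toLp_sub, add_sub_cancel_right, WithLp.toLp_smul, norm_smul,
      Real.norm_of_nonneg hδ.le, ← hδC]
    gcongr
    linarith [hC i]
  · rw [hE]
    simp only [D, one_mulVec, smul_mulVec]
    rw [smul_add, add_neg_cancel_right, inv_smul_smul₀ hδ.ne', hy i]
    exact add_neg_cancel_right _ _
end
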